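/- arXiv:hep-th/0608126 — 3 statements merged into one kernel-verified Lean document; each statement's English description precedes it below -/
import Mathlib

section
/- For −1 ≤ α ≤ 1, the real vector space of derivations of g_α has dimension 9 if α ≠ 1 and dimension 11 if α = 1. -/
/-- The underlying space `ℝ⁸` of the family `g_α`. -/
abbrev V8 : Type := Fin 8 → ℝ

/-- The standard basis vector `X_{k+1}` (0-indexed: `e8 k`). -/
def e8 (k : Fin 8) : V8 := fun l => if l = k then 1 else 0

/-- Brackets of basis elements of `g_α` for `i < j` (0-indexed, `X_{i+1} = e8 i`):
`u α i j = [X_{i+1}, X_{j+1}]`. -/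
noncomputable def gUpper (α : ℝ) : Fin 8 → Fin 8 → V8 := fun i j =>
  match (i : ℕ), (j : ℕ) with
  | 0, 1 => (2 : ℝ) • e8 1          -- [X₁,X₂] = 2X₂
  | 0, 2 => (-2 : ℝ) • e8 2         -- [X₁,X₃] = −2X₃
  | 1, 2 => e8 0                    -- [X₂,X₃] = X₁
  | 0, 3 => e8 3                    -- [X₁,X₄] = X₄
  | 0, 4 => -e8 4                   -- [X₁,X₅] = −X₅
  | 0, 5 => e8 5                    -- [X₁,X₆] = X₆
  | 0, 6 => -e8 6                   -- [X₁,X₇] = −X₇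
  | 1, 4 => e8 3                    -- [X₂,X₅] = X₄
  | 1, 6 => e8 5                    -- [X₂,X₇] = X₆
  | 2, 3 => e8 4                    -- [X₃,X₄] = X₅
  | 2, 5 => e8 6                    -- [X₃,X₆] = X₇
  | 3, 7 => e8 3                    -- [X₄,X₈] = X₄
  | 4, 7 => e8 4                    -- [X₅,X₈] = X₅
  | 5, 7 => α • e8 5                -- [X₆,X₈] = αX₆
  | 6, 7 => α • e8 6                -- [X₇,X₈] = αX₇
  | _, _ => 0

/-- The structure constants `C_{ij}^k` of `g_α`. -/
noncomputable def gC (α : ℝ) (i j k : Fin 8) : ℝ := gUpper α i j k - gUpper α j i k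

/-- The bilinear map on `ℝ⁸` with structure constants `C`. -/
noncomputable def brOf (C : Fin 8 → Fin 8 → Fin 8 → ℝ) : V8 →ₗ[ℝ] V8 →ₗ[ℝ] V8 :=
  LinearMap.mk₂ ℝ (fun x y k => ∑ i, ∑ j, C i j k * x i * y j)
    (by
      intro x x' y
      funext k
      simp only [Pi.add_apply]
      rw [← Finset.sum_add_distrib]
      refine Finset.sum_congr rfl fun i _ => ?_
      rw [← Finset.sum_add_distrib]
      exact Finset.sum_congr rfl fun j _ => by ring)
    (by
      intro c x y
      funext k
      simp only [Pi.smul_apply, smul_eq_mul]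
      rw [Finset.mul_sum]
      refine Finset.sum_congr rfl fun i _ => ?_
      rw [Finset.mul_sum]
      exact Finset.sum_congr rfl fun j _ => by ring)
    (by
      intro x y y'
      funext k
      simp only [Pi.add_apply]
      rw [← Finset.sum_add_distrib]
      refine Finset.sum_congr rfl fun i _ => ?_
      rw [← Finset.sum_add_distrib]
      exact Finset.sum_congr rfl fun j _ => by ring)
    (by
      intro c x y
      funext k
      simp only [Pi.smul_apply, smul_eq_mul]
      rw [Finset.mul_sum]
      refine Finset.sum_congr rfl fun i _ => ?_
      rw [Finset.mul_sum]
      exact Finset.sum_congr rfl fun j _ => by ring)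

/-- The Lie bracket `μ_α` of the Lie algebra `g_α`, as a bilinear map on `ℝ⁸`. -/
noncomputable def brA (α : ℝ) : V8 →ₗ[ℝ] V8 →ₗ[ℝ] V8 := brOf (gC α)

/-- The space of derivations of `g_α`: linear maps `D : ℝ⁸ → ℝ⁸` with
`D[x,y] = [Dx,y] + [x,Dy]`. -/
noncomputable def DerA (α : ℝ) : Submodule ℝ (V8 →ₗ[ℝ] V8) where
  carrier := {D | ∀ x y : V8, D (brA α x y) = brA α (D x) y + brA α x (D y)}
  add_mem' := by
    intro D E hD hE
    intro x y
    simp only [LinearMap.add_apply, hD x y, hE x y, map_add]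
    abel
  zero_mem' := by intro x y; simp
  smul_mem' := by
    intro c D hD x y
    simp only [LinearMap.smul_apply, hD x y, map_smul, smul_add, LinearMap.smul_apply]

set_option maxHeartbeats 2000000 in
/-- The bracket of `g_α` in coordinates. -/
theorem brA_apply (α : ℝ) (x y : V8) : brA α x y =
    ![x 1 * y 2 - x 2 * y 1,
      2 * (x 0 * y 1 - x 1 * y 0),
      -2 * (x 0 * y 2 - x 2 * y 0),
      x 0 * y 3 - x 3 * y 0 + (x 1 * y 4 - x 4 * y 1) + (x 3 * y 7 - x 7 * y 3),
      -(x 0 * y 4 - x 4 * y 0) + (x 2 * y 3 - x 3 * y 2) + (x 4 * y 7 - x 7 * y 4),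
      x 0 * y 5 - x 5 * y 0 + (x 1 * y 6 - x 6 * y 1) + α * (x 5 * y 7 - x 7 * y 5),
      -(x 0 * y 6 - x 6 * y 0) + (x 2 * y 5 - x 5 * y 2) + α * (x 6 * y 7 - x 7 * y 6),
      0] := by
  funext k
  simp [brA, brOf, gC, gUpper, Fin.sum_univ_eight]
  fin_cases k <;> simp [e8] <;> ring

/-- The general derivation of `g_α` (for `α ≠ 1` with `m = n = 0`) as a matrix. -/
noncomputable def derMatrix (α : ℝ) (p : Fin 9 → ℝ) (m n : ℝ) : Matrix (Fin 8) (Fin 8) ℝ :=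
  !![0, -p 1 / 2, -p 0 / 2, 0, 0, 0, 0, 0;
    p 0, p 2, 0, 0, 0, 0, 0, 0;
    p 1, 0, -p 2, 0, 0, 0, 0, 0;
    p 3, -p 4, 0, p 7, -p 0 / 2, n, 0, -p 3;
    p 4, 0, p 3, p 1 / 2, p 7 - p 2, 0, n, p 4;
    p 5, -p 6, 0, m, 0, p 8, -p 0 / 2, -α * p 5;
    p 6, 0, p 5, 0, m, p 1 / 2, p 8 - p 2, α * p 6;
    0, 0, 0, 0, 0, 0, 0, 0]

theorem toLin'_derMatrix_mem_DerA {α : ℝ} (p : Fin 9 → ℝ) {m n : ℝ}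
    (hm : (1 - α) * m = 0) (hn : (1 - α) * n = 0) :
    Matrix.toLin' (derMatrix α p m n) ∈ DerA α := by
  intro x y
  funext k
  have hm' : α * m = m := by linear_combination -hm
  have hn' : α * n = n := by linear_combination -hn
  fin_cases k <;>
    simp [brA_apply, derMatrix, Matrix.mulVec, dotProduct, Fin.sum_univ_eight] <;> grind

set_option maxHeartbeats 4000000 in
theorem eq_derMatrix_of_mem_DerA {α : ℝ} {M : Matrix (Fin 8) (Fin 8) ℝ}
    (hM : Matrix.toLin' M ∈ DerA α) :
    M = derMatrix α ![M 1 0, M 2 0, M 1 1, M 3 0, M 4 0, M 5 0, M 6 0, M 3 3, M 5 5]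
        (M 5 3) (M 3 5) ∧
      (1 - α) * M 5 3 = 0 ∧ (1 - α) * M 3 5 = 0 := by
  have h (i j : Fin 8) := hM (e8 i) (e8 j)
  have h01 := h 0 1
  have h02 := h 0 2
  have h12 := h 1 2
  have h03 := h 0 3
  have h05 := h 0 5
  have h23 := h 2 3
  have h14 := h 1 4
  have h25 := h 2 5
  have h16 := h 1 6
  have h07 := h 0 7
  have h17 := h 1 7
  have h27 := h 2 7
  have h37 := h 3 7
  have h57 := h 5 7
  clear h hM
  simp [brA_apply, e8, funext_iff, Fin.forall_fin_succ, Matrix.mulVec, dotProduct,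
    Fin.sum_univ_eight] at h01 h02 h12 h03 h05 h23 h14 h25 h16 h07 h17 h27 h37 h57
  refine ⟨?_, by linarith, by linarith⟩
  simp [derMatrix, ← Matrix.ext_iff, Fin.forall_fin_succ]
  grind

/-- Selected matrix entries of a derivation, as a linear map. -/
noncomputable def derEntries (α : ℝ) {n : ℕ} (r c : Fin n → Fin 8) : DerA α →ₗ[ℝ] (Fin n → ℝ) :=
  LinearMap.pi fun t => Matrix.entryLinearMap ℝ ℝ (r t) (c t) ∘ₗ
    LinearMap.toMatrix'.toLinearMap ∘ₗ (DerA α).subtype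

theorem finrank_DerA_eq {α : ℝ} {n : ℕ} (r c : Fin n → Fin 8)
    (h : Function.Bijective (derEntries α r c)) : Module.finrank ℝ (DerA α) = n := by
  simpa using (LinearEquiv.ofBijective _ h).finrank_eq

theorem toMatrix'_eq_derMatrix {α : ℝ} (D : DerA α) :
    let M := LinearMap.toMatrix' D.1
    M = derMatrix α ![M 1 0, M 2 0, M 1 1, M 3 0, M 4 0, M 5 0, M 6 0, M 3 3, M 5 5]
        (M 5 3) (M 3 5) ∧
      (1 - α) * M 5 3 = 0 ∧ (1 - α) * M 3 5 = 0 :=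
  eq_derMatrix_of_mem_DerA (by simp)

theorem finrank_DerA_of_ne_one {α : ℝ} (hα : α ≠ 1) : Module.finrank ℝ (DerA α) = 9 := by
  refine finrank_DerA_eq ![1, 2, 1, 3, 4, 5, 6, 3, 5] ![0, 0, 1, 0, 0, 0, 0, 3, 5]
    ⟨(injective_iff_map_eq_zero _).2 fun D hD => ?_, fun p => ?_⟩
  · obtain ⟨hM, hm, hn⟩ := toMatrix'_eq_derMatrix D
    have hα' : 1 - α ≠ 0 := sub_ne_zero.2 hα.symm
    replace hm := (mul_eq_zero.1 hm).resolve_left hα'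
    replace hn := (mul_eq_zero.1 hn).resolve_left hα'
    simp [derEntries, funext_iff, Fin.forall_fin_succ, -LinearMap.toMatrix'_apply] at hD
    apply Subtype.ext
    apply LinearMap.toMatrix'.injective
    rw [hM]
    ext k l
    fin_cases k <;> fin_cases l <;> simp [derMatrix, hD, hm, hn, -LinearMap.toMatrix'_apply]
  · refine ⟨⟨_, toLin'_derMatrix_mem_DerA p (m := 0) (n := 0) (by simp) (by simp)⟩, ?_⟩
    funext t
    fin_cases t <;> simp [derEntries, derMatrix, -LinearMap.toMatrix'_apply]

theorem finrank_DerA_one : Module.finrank ℝ (DerA 1) = 11 := by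
  refine finrank_DerA_eq ![1, 2, 1, 3, 4, 5, 6, 3, 5, 5, 3] ![0, 0, 1, 0, 0, 0, 0, 3, 5, 3, 5]
    ⟨(injective_iff_map_eq_zero _).2 fun D hD => ?_, fun p => ?_⟩
  · obtain ⟨hM, -, -⟩ := toMatrix'_eq_derMatrix D
    simp [derEntries, funext_iff, Fin.forall_fin_succ, -LinearMap.toMatrix'_apply] at hD
    apply Subtype.ext
    apply LinearMap.toMatrix'.injective
    rw [hM]
    ext k l
    fin_cases k <;> fin_cases l <;> simp [derMatrix, hD, -LinearMap.toMatrix'_apply]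
  · refine ⟨⟨_, toLin'_derMatrix_mem_DerA ![p 0, p 1, p 2, p 3, p 4, p 5, p 6, p 7, p 8]
      (m := p 9) (n := p 10) (by simp) (by simp)⟩, ?_⟩
    funext t
    fin_cases t <;> simp [derEntries, derMatrix, -LinearMap.toMatrix'_apply]

/-- For `−1 ≤ α ≤ 1`, the derivation algebra of `g_α` has dimension 9 if `α ≠ 1`
and dimension 11 if `α = 1`. -/
theorem dim_derivations_of_family (α : ℝ) (hα : α ∈ Set.Icc (-1 : ℝ) 1) :
    (α ≠ 1 → Module.finrank ℝ (DerA α) = 9) ∧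
    (α = 1 → Module.finrank ℝ (DerA α) = 11) := by
  exact ⟨finrank_DerA_of_ne_one, fun h => h ▸ finrank_DerA_one⟩
end

section
/- For every α with −1 < α ≤ 1, the third Chevalley–Eilenberg cohomology of g_α with coefficients in the adjoint module vanishes: H^3(g_α, g_α) = 0. -/
open Filter Topology Set

namespace CE

variable {V W : Type} [AddCommGroup V] [Module ℝ V] [AddCommGroup W] [Module ℝ W]

/-- The Chevalley–Eilenberg coboundary of a `p`-cochain `Φ` (an alternating `p`-linear
map `V^p → W`), relative to a bracket `br` on `V` and an action `ρ` of `V` on `W`,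
evaluated on a `(p+1)`-tuple `X` (indices `0,…,p` correspond to `X_1,…,X_{p+1}`):
`dΦ(X_0,…,X_p) = Σ_s (−1)^s ρ(X_s)(Φ(…,X̂_s,…))
  + Σ_{s<t} (−1)^{s+t} Φ(br(X_s,X_t),…,X̂_s,…,X̂_t,…)`. -/
def ceDfun (br : V →ₗ[ℝ] V →ₗ[ℝ] V) (ρ : V →ₗ[ℝ] W →ₗ[ℝ] W) {p : ℕ}
    (Φ : V [⋀^Fin p]→ₗ[ℝ] W) (X : Fin (p + 1) → V) : W :=
  (∑ s : Fin (p + 1), ((-1 : ℝ) ^ (s : ℕ)) • ρ (X s) (Φ (X ∘ s.succAbove)))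
  + ∑ s : Fin (p + 1), ∑ t : Fin (p + 1),
      if (s : ℕ) < (t : ℕ) then
        ((-1 : ℝ) ^ ((s : ℕ) + (t : ℕ))) • Φ (fun i : Fin p =>
          if (i : ℕ) = 0 then br (X s) (X t)
          else if (i : ℕ) - 1 < (s : ℕ) then X ⟨(i : ℕ) - 1, by have := i.isLt; omega⟩
          else if (i : ℕ) < (t : ℕ) then X ⟨(i : ℕ), by have := i.isLt; omega⟩
          else X ⟨(i : ℕ) + 1, by have := i.isLt; omega⟩)
      else 0

/-- The Chevalley–Eilenberg coboundary, as a linear map into functions. -/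
def ceD (br : V →ₗ[ℝ] V →ₗ[ℝ] V) (ρ : V →ₗ[ℝ] W →ₗ[ℝ] W) (p : ℕ) :
    (V [⋀^Fin p]→ₗ[ℝ] W) →ₗ[ℝ] ((Fin (p + 1) → V) → W) where
  toFun Φ := ceDfun br ρ Φ
  map_add' Φ Ψ := by
    have key : ∀ {c : Prop} [Decidable c] (a b : W),
        (if c then a + b else 0) = (if c then a else 0) + (if c then b else 0) := by
      intro c _ a b; split <;> simp
    funext X
    simp only [ceDfun, AlternatingMap.add_apply, map_add, smul_add, Pi.add_apply,
      key, Finset.sum_add_distrib]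
    abel
  map_smul' c Φ := by
    funext X
    simp only [ceDfun, AlternatingMap.smul_apply, map_smul, RingHom.id_apply, Pi.smul_apply,
      smul_add, Finset.smul_sum, smul_ite, smul_zero, smul_smul, mul_comm]

/-- Evaluation of an alternating map as a plain function, as a linear map. -/
def altEval (q : ℕ) : (V [⋀^Fin q]→ₗ[ℝ] W) →ₗ[ℝ] ((Fin q → V) → W) where
  toFun Ψ := ⇑Ψ
  map_add' a b := by funext X; simp
  map_smul' c a := by funext X; simp

/-- The space `Z^p` of `p`-cocycles. -/
def ceZ (br : V →ₗ[ℝ] V →ₗ[ℝ] V) (ρ : V →ₗ[ℝ] W →ₗ[ℝ] W) (p : ℕ) :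
    Submodule ℝ (V [⋀^Fin p]→ₗ[ℝ] W) :=
  LinearMap.ker (ceD br ρ p)

/-- The space `B^p` of `p`-coboundaries (`B^0 = 0`). -/
def ceB (br : V →ₗ[ℝ] V →ₗ[ℝ] V) (ρ : V →ₗ[ℝ] W →ₗ[ℝ] W) :
    (p : ℕ) → Submodule ℝ (V [⋀^Fin p]→ₗ[ℝ] W)
  | 0 => ⊥
  | (p + 1) => Submodule.comap (altEval (p + 1)) (LinearMap.range (ceD br ρ p))

/-- The `p`-th Chevalley–Eilenberg cohomology space `H^p = Z^p / B^p`. -/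
def CEH (br : V →ₗ[ℝ] V →ₗ[ℝ] V) (ρ : V →ₗ[ℝ] W →ₗ[ℝ] W) (p : ℕ) : Type :=
  ceZ br ρ p ⧸ Submodule.comap (ceZ br ρ p).subtype (ceB br ρ p)

noncomputable instance (br : V →ₗ[ℝ] V →ₗ[ℝ] V) (ρ : V →ₗ[ℝ] W →ₗ[ℝ] W) (p : ℕ) :
    AddCommGroup (CEH br ρ p) :=
  inferInstanceAs (AddCommGroup (ceZ br ρ p ⧸ Submodule.comap (ceZ br ρ p).subtype (ceB br ρ p)))

noncomputable instance (br : V →ₗ[ℝ] V →ₗ[ℝ] V) (ρ : V →ₗ[ℝ] W →ₗ[ℝ] W) (p : ℕ) :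
    Module ℝ (CEH br ρ p) :=
  inferInstanceAs (Module ℝ (ceZ br ρ p ⧸ Submodule.comap (ceZ br ρ p).subtype (ceB br ρ p)))

/-- `dim H^p`. -/
noncomputable def Hdim (br : V →ₗ[ℝ] V →ₗ[ℝ] V) (ρ : V →ₗ[ℝ] W →ₗ[ℝ] W) (p : ℕ) : ℕ :=
  Module.finrank ℝ (CEH br ρ p)

end CE

/-- Integer weights of the basis under `ad X₁`. -/
def hWt : Fin 8 → ℤ := ![0, 2, -2, 1, -1, 1, -1, 0]

/-- The degree of the basis in `X₄, X₅`. -/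
def pWt : Fin 8 → ℤ := ![0, 0, 0, 1, 1, 0, 0, 0]

/-- The degree of the basis in `X₆, X₇`. -/
def qWt : Fin 8 → ℤ := ![0, 0, 0, 0, 0, 1, 1, 0]

/-- The weights of the basis under the torus spanned by `X₈` and `X₁`. -/
def torusWt (α : ℝ) (i : Fin 8) : ℝ × ℝ := (-(pWt i + α * qWt i), hWt i)

lemma gC_swap (α : ℝ) (i j k : Fin 8) : gC α i j k = -gC α j i k := by
  simp [gC]

lemma gC_zero_left (α : ℝ) (i k : Fin 8) :
    gC α 0 i k = if i = k then (torusWt α i).2 else 0 := by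
  fin_cases i <;> fin_cases k <;> simp [gC, gUpper, e8, torusWt, hWt]

lemma gC_seven_left (α : ℝ) (i k : Fin 8) :
    gC α 7 i k = if i = k then (torusWt α i).1 else 0 := by
  fin_cases i <;> fin_cases k <;> simp [gC, gUpper, e8, torusWt, pWt, qWt]

lemma torusWt_add_of_gUpper_ne_zero {α : ℝ} {i j k : Fin 8} (h : gUpper α i j k ≠ 0) :
    torusWt α i + torusWt α j = torusWt α k := by
  fin_cases i <;> fin_cases j <;> simp [gUpper, e8] at h <;>
    (first | subst h | obtain ⟨rfl, -⟩ := h) <;>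
    simp [torusWt, pWt, qWt, hWt] <;> norm_num

lemma torusWt_add_of_gC_ne_zero {α : ℝ} {i j k : Fin 8} (h : gC α i j k ≠ 0) :
    torusWt α i + torusWt α j = torusWt α k := by
  by_cases h₀ : gUpper α i j k = 0
  · rw [add_comm]
    exact torusWt_add_of_gUpper_ne_zero fun h₁ => h (by simp [gC, h₀, h₁])
  · exact torusWt_add_of_gUpper_ne_zero h₀

/-- The coboundary of a 2-cochain in coordinates. -/
noncomputable def cobd₂ (C g : Fin 8 → Fin 8 → Fin 8 → ℝ) (a b c l : Fin 8) : ℝ :=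
  ∑ m, C a m l * g b c m - ∑ m, C b m l * g a c m + ∑ m, C c m l * g a b m
    - ∑ m, C a b m * g m c l + ∑ m, C a c m * g m b l - ∑ m, C b c m * g m a l

/-- The coboundary of a 3-cochain in coordinates. -/
noncomputable def cobd₃ (C : Fin 8 → Fin 8 → Fin 8 → ℝ) (f : Fin 8 → Fin 8 → Fin 8 → Fin 8 → ℝ)
    (a b c d l : Fin 8) : ℝ :=
  ∑ m, C a m l * f b c d m - ∑ m, C b m l * f a c d m + ∑ m, C c m l * f a b d m
    - ∑ m, C d m l * f a b c m
    - ∑ m, C a b m * f m c d l + ∑ m, C a c m * f m b d l - ∑ m, C a d m * f m b c l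
    - ∑ m, C b c m * f m a d l + ∑ m, C b d m * f m a c l - ∑ m, C c d m * f m a b l

/-- Cartan's formula for an element `x` acting diagonally with weights `w`. -/
lemma cobd₃_add_cobd₂_contract {C : Fin 8 → Fin 8 → Fin 8 → ℝ}
    {f : Fin 8 → Fin 8 → Fin 8 → Fin 8 → ℝ} {w : Fin 8 → ℝ} {x : Fin 8}
    (hC : ∀ i k, C x i k = if i = k then w i else 0)
    (h₁ : ∀ a b c l, f a b c l = -f b a c l) (h₂ : ∀ a b c l, f a b c l = -f a c b l)
    (a b c l : Fin 8) :
    cobd₃ C f x a b c l + cobd₂ C (f x) a b c l = (w l - w a - w b - w c) * f a b c l := by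
  have e (u v : Fin 8) : ∀ m, f m x u v = -f x m u v := fun m => h₁ _ _ _ _
  simp only [cobd₃, cobd₂, hC, ite_mul, zero_mul, e, mul_neg, Finset.sum_neg_distrib,
    Finset.sum_ite_eq, Finset.sum_ite_eq', Finset.mem_univ, if_true]
  rw [h₁ b a c l, h₁ c a b l, h₂ a c b l]
  ring

/-- The coboundary preserves weights. -/
lemma cobd₂_congr_of_weight {C g g' : Fin 8 → Fin 8 → Fin 8 → ℝ}
    {w : Fin 8 → ℝ × ℝ} (hC : ∀ {i j k}, C i j k ≠ 0 → w i + w j = w k) {a b c l : Fin 8}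
    (h : ∀ i j k, w i + w j - w k = w a + w b + w c - w l → g i j k = g' i j k) :
    cobd₂ C g a b c l = cobd₂ C g' a b c l := by
  have key {i j k u v t : Fin 8}
      (hw : w i + w j = w k → w u + w v - w t = w a + w b + w c - w l) :
      C i j k * g u v t = C i j k * g' u v t := by
    by_cases h0 : C i j k = 0
    · simp [h0]
    · rw [h _ _ _ (hw (hC h0))]
  unfold cobd₂
  congr 1; congr 1; congr 1; congr 1; congr 1
  all_goals
    refine Finset.sum_congr rfl fun m _ => key fun hw => ?_
    linear_combination -hw

lemma cobd₂_smul (C g : Fin 8 → Fin 8 → Fin 8 → ℝ) (r : ℝ) (a b c l : Fin 8) :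
    cobd₂ C (fun i j k => r * g i j k) a b c l = r * cobd₂ C g a b c l := by
  simp only [cobd₂, mul_left_comm _ r, ← Finset.mul_sum]
  ring

lemma cobd₂_swap_left {C g : Fin 8 → Fin 8 → Fin 8 → ℝ} (hC : ∀ i j k, C i j k = -C j i k)
    (hg : ∀ i j k, g i j k = -g j i k) (a b c l : Fin 8) :
    cobd₂ C g a b c l = -cobd₂ C g b a c l := by
  simp only [cobd₂, hC b a, hg b a, neg_mul, mul_neg, Finset.sum_neg_distrib]
  ring

lemma cobd₂_swap_right {C g : Fin 8 → Fin 8 → Fin 8 → ℝ} (hC : ∀ i j k, C i j k = -C j i k)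
    (hg : ∀ i j k, g i j k = -g j i k) (a b c l : Fin 8) :
    cobd₂ C g a b c l = -cobd₂ C g a c b l := by
  simp only [cobd₂, hC c b, hg c b, neg_mul, mul_neg, Finset.sum_neg_distrib]
  ring

/-- An alternating function of three indices vanishes if it does so on increasing indices. -/
lemma eq_zero_of_increasing {F : Fin 8 → Fin 8 → Fin 8 → ℝ} (h₁ : ∀ a b c, F a b c = -F b a c)
    (h₂ : ∀ a b c, F a b c = -F a c b) (h : ∀ a b c, a < b → b < c → F a b c = 0)
    (a b c : Fin 8) : F a b c = 0 := by
  have r₁ (a c) : F a a c = 0 := by linarith [h₁ a a c]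
  have r₂ (a b) : F a b b = 0 := by linarith [h₂ a b b]
  grind

lemma sum_gC_bracket (α : ℝ) (F : Fin 8 → ℝ) (a b : Fin 8) :
    ∑ m, gC α a b m * F m =
      (![![0, 2 * F 1, -2 * F 2, F 3, -F 4, F 5, -F 6, 0],
        ![-2 * F 1, 0, F 0, 0, F 3, 0, F 5, 0],
        ![2 * F 2, -F 0, 0, F 4, 0, F 6, 0, 0],
        ![-F 3, 0, -F 4, 0, 0, 0, 0, F 3],
        ![F 4, -F 3, 0, 0, 0, 0, 0, F 4],
        ![-F 5, 0, -F 6, 0, 0, 0, 0, α * F 5],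
        ![F 6, -F 5, 0, 0, 0, 0, 0, α * F 6],
        ![0, 0, 0, -F 3, -F 4, -α * F 5, -α * F 6, 0]] : Fin 8 → Fin 8 → ℝ) a b := by
  fin_cases a <;> fin_cases b <;> simp [gC, gUpper, e8]

set_option maxHeartbeats 1000000 in
lemma sum_gC_action (α : ℝ) (F : Fin 8 → ℝ) (a l : Fin 8) :
    ∑ m, gC α a m l * F m =
      (![![0, 2 * F 1, -2 * F 2, F 3, -F 4, F 5, -F 6, 0],
        ![F 2, -2 * F 0, 0, F 4, 0, F 6, 0, 0],
        ![-F 1, 0, 2 * F 0, 0, F 3, 0, F 5, 0],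
        ![0, 0, 0, F 7 - F 0, -F 2, 0, 0, 0],
        ![0, 0, 0, -F 1, F 0 + F 7, 0, 0, 0],
        ![0, 0, 0, 0, 0, α * F 7 - F 0, -F 2, 0],
        ![0, 0, 0, 0, 0, -F 1, F 0 + α * F 7, 0],
        ![0, 0, 0, -F 3, -F 4, -α * F 5, -α * F 6, 0]] : Fin 8 → Fin 8 → ℝ) a l := by
  have h (m : Fin 8) := sum_gC_bracket α (fun k => if k = l then 1 else 0) a m
  simp only [mul_ite, mul_one, mul_zero, Finset.sum_ite_eq', Finset.mem_univ, if_true] at h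
  simp only [Fin.sum_univ_eight, h]
  fin_cases a <;> fin_cases l <;> simp <;> ring

/-- Upper triangular part of a primitive of the torus-invariant 3-cocycle `f`. -/
noncomputable def invPrimitiveUpper (f : Fin 8 → Fin 8 → Fin 8 → Fin 8 → ℝ) :
    Fin 8 → Fin 8 → Fin 8 → ℝ :=
  ![![0, 0,
      ![0, 0, -f 0 1 2 0, 0, 0, 0, 0, 0],
      ![0, 0, 0, (f 0 1 4 3 - f 1 2 3 3 - f 1 2 4 4) / 2, 0,
        (f 0 1 4 5 - f 1 2 3 5 - f 1 2 4 6) / 2, 0, 0],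
      ![0, 0, 0, 0, -(f 0 1 4 3 + f 1 2 3 3 + f 1 2 4 4) / 2, 0,
        -(f 0 1 4 5 + f 1 2 3 5 + f 1 2 4 6) / 2, 0],
      ![0, 0, 0, (f 0 1 6 3 - f 1 2 5 3 - f 1 2 6 4) / 2, 0,
        (f 0 1 6 5 - f 1 2 5 5 - f 1 2 6 6) / 2, 0, 0],
      ![0, 0, 0, 0, -(f 0 1 6 3 + f 1 2 5 3 + f 1 2 6 4) / 2, 0,
        -(f 0 1 6 5 + f 1 2 5 5 + f 1 2 6 6) / 2, 0],
      ![f 0 1 7 1 / 2, 0, 0, 0, 0, 0, 0, -f 1 2 7 7]],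
    ![0, 0, 0, 0,
      ![0, 0, 0, (f 0 1 4 3 + f 1 2 3 3 - f 1 2 4 4) / 2, 0,
        (f 0 1 4 5 + f 1 2 3 5 - f 1 2 4 6) / 2, 0, 0],
      0,
      ![0, 0, 0, (f 0 1 6 3 + f 1 2 5 3 - f 1 2 6 4) / 2, 0,
        (f 0 1 6 5 + f 1 2 5 5 - f 1 2 6 6) / 2, 0, 0],
      ![0, f 1 2 7 0 + f 0 1 7 1 / 2, 0, 0, 0, 0, 0, 0]],
    0, 0,
    ![0, 0, 0, 0, 0, 0, 0,
      ![0, 0, 0, 0, f 1 4 7 3 - f 1 2 7 0 - f 0 1 7 1 / 2, 0, f 1 4 7 5, 0]],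
    ![0, 0, 0, 0, 0, 0,
      ![-f 1 5 6 1 / 2, 0, 0, 0, 0, 0, 0, f 3 5 6 3 - f 1 5 6 1 / 2],
      0],
    ![0, 0, 0, 0, 0, 0, 0,
      ![0, 0, 0, 0, f 1 6 7 3, 0, f 1 6 7 5 - f 1 2 7 0 - f 0 1 7 1 / 2, 0]],
    0]

/-- A primitive of the torus-invariant part of a 3-cocycle `f`. -/
noncomputable def invPrimitive (f : Fin 8 → Fin 8 → Fin 8 → Fin 8 → ℝ) (i j l : Fin 8) : ℝ :=
  invPrimitiveUpper f i j l - invPrimitiveUpper f j i l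

set_option synthInstance.maxSize 2000 in
set_option synthInstance.maxHeartbeats 400000 in
lemma increasing_invariant_cases : ∀ a b c l : Fin 8, a < b → b < c →
    hWt a + hWt b + hWt c = hWt l →
    (pWt a + pWt b + pWt c - pWt l, qWt a + qWt b + qWt c - qWt l) ∈
        ([(2, 0), (1, 1)] : List (ℤ × ℤ)) ∨
    (pWt a + pWt b + pWt c - pWt l, qWt a + qWt b + qWt c - qWt l) = (0, 0) ∧
      (a, b, c, l) ∈ ([(0, 1, 2, 0), (0, 1, 2, 7), (0, 1, 4, 3), (0, 1, 6, 5), (0, 1, 7, 1),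
        (0, 2, 3, 4), (0, 2, 5, 6), (0, 2, 7, 2), (0, 3, 7, 3), (0, 4, 7, 4), (0, 5, 7, 5),
        (0, 6, 7, 6), (1, 2, 3, 3), (1, 2, 4, 4), (1, 2, 5, 5), (1, 2, 6, 6), (1, 2, 7, 0),
        (1, 2, 7, 7), (1, 4, 7, 3), (1, 6, 7, 5), (2, 3, 7, 4), (2, 5, 7, 6)] :
        List (Fin 8 × Fin 8 × Fin 8 × Fin 8)) ∨
    (pWt a + pWt b + pWt c - pWt l, qWt a + qWt b + qWt c - qWt l) = (0, 2) ∧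
      (a, b, c, l) ∈ ([(0, 5, 6, 0), (0, 5, 6, 7), (1, 5, 6, 1), (2, 5, 6, 2), (3, 5, 6, 3),
        (4, 5, 6, 4), (5, 6, 7, 0), (5, 6, 7, 7)] : List (Fin 8 × Fin 8 × Fin 8 × Fin 8)) ∨
    (pWt a + pWt b + pWt c - pWt l, qWt a + qWt b + qWt c - qWt l) = (1, -1) ∧
      (a, b, c, l) ∈ ([(0, 1, 4, 5), (0, 2, 3, 6), (0, 3, 7, 5), (0, 4, 7, 6), (1, 2, 3, 5),
        (1, 2, 4, 6), (1, 4, 7, 5), (2, 3, 7, 6)] : List (Fin 8 × Fin 8 × Fin 8 × Fin 8)) ∨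
    (pWt a + pWt b + pWt c - pWt l, qWt a + qWt b + qWt c - qWt l) = (-1, 1) ∧
      (a, b, c, l) ∈ ([(0, 1, 6, 3), (0, 2, 5, 4), (0, 5, 7, 3), (0, 6, 7, 4), (1, 2, 5, 3),
        (1, 2, 6, 4), (1, 6, 7, 3), (2, 5, 7, 4)] : List (Fin 8 × Fin 8 × Fin 8 × Fin 8)) := by
  decide +kernel

set_option maxHeartbeats 4000000 in
lemma cobd₂_invPrimitive_zero_zero {α : ℝ} {f : Fin 8 → Fin 8 → Fin 8 → Fin 8 → ℝ}
    (h₁ : ∀ a b c l, f a b c l = -f b a c l) (h₂ : ∀ a b c l, f a b c l = -f a c b l)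
    (hf : ∀ a b c d l, cobd₃ (gC α) f a b c d l = 0) {a b c l : Fin 8}
    (h : (a, b, c, l) ∈ ([(0, 1, 2, 0), (0, 1, 2, 7), (0, 1, 4, 3), (0, 1, 6, 5), (0, 1, 7, 1),
      (0, 2, 3, 4), (0, 2, 5, 6), (0, 2, 7, 2), (0, 3, 7, 3), (0, 4, 7, 4), (0, 5, 7, 5),
      (0, 6, 7, 6), (1, 2, 3, 3), (1, 2, 4, 4), (1, 2, 5, 5), (1, 2, 6, 6), (1, 2, 7, 0),
      (1, 2, 7, 7), (1, 4, 7, 3), (1, 6, 7, 5), (2, 3, 7, 4), (2, 5, 7, 6)] :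
      List (Fin 8 × Fin 8 × Fin 8 × Fin 8))) :
    cobd₂ (gC α) (invPrimitive f) a b c l = f a b c l := by
  have s₁ {a b c l : Fin 8} (_ : b < a) : f a b c l = -f b a c l := h₁ a b c l
  have s₂ {a b c l : Fin 8} (_ : c < b) : f a b c l = -f a c b l := h₂ a b c l
  have r₁ (a c l : Fin 8) : f a a c l = 0 := by linarith [h₁ a a c l]
  have k0 := hf 0 1 2 3 3
  have k1 := hf 0 1 2 4 4
  have k2 := hf 0 1 2 5 5
  have k3 := hf 0 1 2 6 6
  have k4 := hf 0 1 2 7 0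
  have k5 := hf 0 1 4 7 3
  have k6 := hf 0 1 6 7 5
  have k7 := hf 0 2 3 7 4
  have k8 := hf 0 2 5 7 6
  have k9 := hf 1 2 3 7 3
  have k10 := hf 1 2 4 7 4
  have k11 := hf 1 2 5 7 5
  have k12 := hf 1 2 6 7 6
  simp [cobd₃, sum_gC_bracket, sum_gC_action, s₁, s₂, r₁]
    at k0 k1 k2 k3 k4 k5 k6 k7 k8 k9 k10 k11 k12
  have e : α * f 0 1 2 7 = 0 := by
    have : f 0 1 2 7 = 0 := by linarith
    rw [this, mul_zero]
  simp only [List.mem_cons, Prod.mk.injEq, List.not_mem_nil, or_false] at h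
  rcases h with ⟨rfl, rfl, rfl, rfl⟩ | ⟨rfl, rfl, rfl, rfl⟩ | ⟨rfl, rfl, rfl, rfl⟩ |
    ⟨rfl, rfl, rfl, rfl⟩ | ⟨rfl, rfl, rfl, rfl⟩ | ⟨rfl, rfl, rfl, rfl⟩ | ⟨rfl, rfl, rfl, rfl⟩ |
    ⟨rfl, rfl, rfl, rfl⟩ | ⟨rfl, rfl, rfl, rfl⟩ | ⟨rfl, rfl, rfl, rfl⟩ | ⟨rfl, rfl, rfl, rfl⟩ |
    ⟨rfl, rfl, rfl, rfl⟩ | ⟨rfl, rfl, rfl, rfl⟩ | ⟨rfl, rfl, rfl, rfl⟩ | ⟨rfl, rfl, rfl, rfl⟩ |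
    ⟨rfl, rfl, rfl, rfl⟩ | ⟨rfl, rfl, rfl, rfl⟩ | ⟨rfl, rfl, rfl, rfl⟩ | ⟨rfl, rfl, rfl, rfl⟩ |
    ⟨rfl, rfl, rfl, rfl⟩ | ⟨rfl, rfl, rfl, rfl⟩ | ⟨rfl, rfl, rfl, rfl⟩ <;>
    simp [cobd₂, sum_gC_bracket, sum_gC_action, invPrimitive, invPrimitiveUpper] <;> linarith

set_option maxHeartbeats 4000000 in
lemma cobd₂_invPrimitive_zero_two {f : Fin 8 → Fin 8 → Fin 8 → Fin 8 → ℝ}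
    (h₁ : ∀ a b c l, f a b c l = -f b a c l) (h₂ : ∀ a b c l, f a b c l = -f a c b l)
    (hf : ∀ a b c d l, cobd₃ (gC 0) f a b c d l = 0) {a b c l : Fin 8}
    (h : (a, b, c, l) ∈ ([(0, 5, 6, 0), (0, 5, 6, 7), (1, 5, 6, 1), (2, 5, 6, 2), (3, 5, 6, 3),
      (4, 5, 6, 4), (5, 6, 7, 0), (5, 6, 7, 7)] :
      List (Fin 8 × Fin 8 × Fin 8 × Fin 8))) :
    cobd₂ (gC 0) (invPrimitive f) a b c l = f a b c l := by
  have s₁ {a b c l : Fin 8} (_ : b < a) : f a b c l = -f b a c l := h₁ a b c l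
  have s₂ {a b c l : Fin 8} (_ : c < b) : f a b c l = -f a c b l := h₂ a b c l
  have r₁ (a c l : Fin 8) : f a a c l = 0 := by linarith [h₁ a a c l]
  have r₂ (a b l : Fin 8) : f a b b l = 0 := by linarith [h₂ a b b l]
  have k0 := hf 0 1 5 6 1
  have k1 := hf 0 2 5 6 2
  have k2 := hf 0 3 5 6 3
  have k3 := hf 0 4 5 6 4
  have k4 := hf 1 2 5 6 0
  have k5 := hf 1 2 5 6 7
  have k6 := hf 1 4 5 6 3
  have k7 := hf 1 5 6 7 1
  have k8 := hf 2 3 5 6 4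
  have k9 := hf 2 5 6 7 2
  have k10 := hf 3 5 6 7 3
  have k11 := hf 4 5 6 7 4
  simp [cobd₃, sum_gC_bracket, sum_gC_action, s₁, s₂, r₁, r₂]
    at k0 k1 k2 k3 k4 k5 k6 k7 k8 k9 k10 k11
  simp only [List.mem_cons, Prod.mk.injEq, List.not_mem_nil, or_false] at h
  rcases h with ⟨rfl, rfl, rfl, rfl⟩ | ⟨rfl, rfl, rfl, rfl⟩ | ⟨rfl, rfl, rfl, rfl⟩ |
    ⟨rfl, rfl, rfl, rfl⟩ | ⟨rfl, rfl, rfl, rfl⟩ | ⟨rfl, rfl, rfl, rfl⟩ | ⟨rfl, rfl, rfl, rfl⟩ |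
    ⟨rfl, rfl, rfl, rfl⟩ <;>
    simp [cobd₂, sum_gC_bracket, sum_gC_action, invPrimitive, invPrimitiveUpper] <;> linarith

set_option maxHeartbeats 4000000 in
lemma cobd₂_invPrimitive_one_neg_one {f : Fin 8 → Fin 8 → Fin 8 → Fin 8 → ℝ}
    (h₁ : ∀ a b c l, f a b c l = -f b a c l) (h₂ : ∀ a b c l, f a b c l = -f a c b l)
    (hf : ∀ a b c d l, cobd₃ (gC 1) f a b c d l = 0) {a b c l : Fin 8}
    (h : (a, b, c, l) ∈ ([(0, 1, 4, 5), (0, 2, 3, 6), (0, 3, 7, 5), (0, 4, 7, 6), (1, 2, 3, 5),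
      (1, 2, 4, 6), (1, 4, 7, 5), (2, 3, 7, 6)] :
      List (Fin 8 × Fin 8 × Fin 8 × Fin 8))) :
    cobd₂ (gC 1) (invPrimitive f) a b c l = f a b c l := by
  have s₁ {a b c l : Fin 8} (_ : b < a) : f a b c l = -f b a c l := h₁ a b c l
  have s₂ {a b c l : Fin 8} (_ : c < b) : f a b c l = -f a c b l := h₂ a b c l
  have r₁ (a c l : Fin 8) : f a a c l = 0 := by linarith [h₁ a a c l]
  have k0 := hf 0 1 2 3 5
  have k1 := hf 0 1 2 4 6
  have k2 := hf 0 1 4 7 5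
  have k3 := hf 0 2 3 7 6
  have k4 := hf 1 2 3 7 5
  have k5 := hf 1 2 4 7 6
  simp [cobd₃, sum_gC_bracket, sum_gC_action, s₁, s₂, r₁] at k0 k1 k2 k3 k4 k5
  simp only [List.mem_cons, Prod.mk.injEq, List.not_mem_nil, or_false] at h
  rcases h with ⟨rfl, rfl, rfl, rfl⟩ | ⟨rfl, rfl, rfl, rfl⟩ | ⟨rfl, rfl, rfl, rfl⟩ |
    ⟨rfl, rfl, rfl, rfl⟩ | ⟨rfl, rfl, rfl, rfl⟩ | ⟨rfl, rfl, rfl, rfl⟩ | ⟨rfl, rfl, rfl, rfl⟩ |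
    ⟨rfl, rfl, rfl, rfl⟩ <;>
    simp [cobd₂, sum_gC_bracket, sum_gC_action, invPrimitive, invPrimitiveUpper] <;> linarith

set_option maxHeartbeats 4000000 in
lemma cobd₂_invPrimitive_neg_one_one {f : Fin 8 → Fin 8 → Fin 8 → Fin 8 → ℝ}
    (h₁ : ∀ a b c l, f a b c l = -f b a c l) (h₂ : ∀ a b c l, f a b c l = -f a c b l)
    (hf : ∀ a b c d l, cobd₃ (gC 1) f a b c d l = 0) {a b c l : Fin 8}
    (h : (a, b, c, l) ∈ ([(0, 1, 6, 3), (0, 2, 5, 4), (0, 5, 7, 3), (0, 6, 7, 4), (1, 2, 5, 3),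
      (1, 2, 6, 4), (1, 6, 7, 3), (2, 5, 7, 4)] :
      List (Fin 8 × Fin 8 × Fin 8 × Fin 8))) :
    cobd₂ (gC 1) (invPrimitive f) a b c l = f a b c l := by
  have s₁ {a b c l : Fin 8} (_ : b < a) : f a b c l = -f b a c l := h₁ a b c l
  have s₂ {a b c l : Fin 8} (_ : c < b) : f a b c l = -f a c b l := h₂ a b c l
  have r₁ (a c l : Fin 8) : f a a c l = 0 := by linarith [h₁ a a c l]
  have k0 := hf 0 1 2 5 3
  have k1 := hf 0 1 2 6 4
  have k2 := hf 0 1 6 7 3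
  have k3 := hf 0 2 5 7 4
  have k4 := hf 1 2 5 7 3
  have k5 := hf 1 2 6 7 4
  simp [cobd₃, sum_gC_bracket, sum_gC_action, s₁, s₂, r₁] at k0 k1 k2 k3 k4 k5
  simp only [List.mem_cons, Prod.mk.injEq, List.not_mem_nil, or_false] at h
  rcases h with ⟨rfl, rfl, rfl, rfl⟩ | ⟨rfl, rfl, rfl, rfl⟩ | ⟨rfl, rfl, rfl, rfl⟩ |
    ⟨rfl, rfl, rfl, rfl⟩ | ⟨rfl, rfl, rfl, rfl⟩ | ⟨rfl, rfl, rfl, rfl⟩ | ⟨rfl, rfl, rfl, rfl⟩ |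
    ⟨rfl, rfl, rfl, rfl⟩ <;>
    simp [cobd₂, sum_gC_bracket, sum_gC_action, invPrimitive, invPrimitiveUpper] <;> linarith

/-- A primitive of the 3-cocycle `f`: contraction with `X₈` or `X₁`, divided by the weight, on the
nonzero weight spaces of the torus they span, and `invPrimitive f` on the invariants. -/
noncomputable def primitive (α : ℝ) (f : Fin 8 → Fin 8 → Fin 8 → Fin 8 → ℝ) (i j k : Fin 8) : ℝ :=
  let μ := torusWt α i + torusWt α j - torusWt α k
  if μ.1 ≠ 0 then -μ.1⁻¹ * f 7 i j k
  else if μ.2 ≠ 0 then -μ.2⁻¹ * f 0 i j k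
  else invPrimitive f i j k

lemma primitive_swap (α : ℝ) {f : Fin 8 → Fin 8 → Fin 8 → Fin 8 → ℝ}
    (h₂ : ∀ a b c l, f a b c l = -f a c b l) (i j k : Fin 8) :
    primitive α f i j k = -primitive α f j i k := by
  simp only [primitive, add_comm (torusWt α j), h₂ _ j i]
  split_ifs <;> simp [invPrimitive]

lemma cobd₂_invPrimitive {α : ℝ} (hα : -1 < α) {f : Fin 8 → Fin 8 → Fin 8 → Fin 8 → ℝ}
    (h₁ : ∀ a b c l, f a b c l = -f b a c l) (h₂ : ∀ a b c l, f a b c l = -f a c b l)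
    (hf : ∀ a b c d l, cobd₃ (gC α) f a b c d l = 0) {a b c l : Fin 8} (hab : a < b) (hbc : b < c)
    (hw : torusWt α a + torusWt α b + torusWt α c - torusWt α l = 0) :
    cobd₂ (gC α) (invPrimitive f) a b c l = f a b c l := by
  have hH : hWt a + hWt b + hWt c = hWt l := by
    have := congrArg Prod.snd hw
    simp only [torusWt, Prod.snd_sub, Prod.snd_add, Prod.snd_zero] at this
    exact_mod_cast sub_eq_zero.mp this
  have hPQ : ((pWt a + pWt b + pWt c - pWt l : ℤ) : ℝ)
      + α * ((qWt a + qWt b + qWt c - qWt l : ℤ) : ℝ) = 0 := by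
    have := congrArg Prod.fst hw
    simp only [torusWt, Prod.fst_sub, Prod.fst_add, Prod.fst_zero] at this
    push_cast
    linear_combination -this
  rcases increasing_invariant_cases a b c l hab hbc hH with h | ⟨-, h⟩ | ⟨h, h'⟩ | ⟨h, h'⟩ | ⟨h, h'⟩
  · simp only [List.mem_cons, Prod.mk.injEq, List.not_mem_nil, or_false] at h
    rcases h with ⟨hP, hQ⟩ | ⟨hP, hQ⟩ <;> rw [hP, hQ] at hPQ <;> push_cast at hPQ <;> linarith
  · exact cobd₂_invPrimitive_zero_zero h₁ h₂ hf h
  · obtain ⟨hP, hQ⟩ := Prod.mk.inj h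
    rw [hP, hQ] at hPQ
    obtain rfl : α = 0 := by push_cast at hPQ; linarith
    exact cobd₂_invPrimitive_zero_two h₁ h₂ hf h'
  · obtain ⟨hP, hQ⟩ := Prod.mk.inj h
    rw [hP, hQ] at hPQ
    obtain rfl : α = 1 := by push_cast at hPQ; linarith
    exact cobd₂_invPrimitive_one_neg_one h₁ h₂ hf h'
  · obtain ⟨hP, hQ⟩ := Prod.mk.inj h
    rw [hP, hQ] at hPQ
    obtain rfl : α = 1 := by push_cast at hPQ; linarith
    exact cobd₂_invPrimitive_neg_one_one h₁ h₂ hf h'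

lemma cobd₂_primitive_of_lt {α : ℝ} (hα : -1 < α) {f : Fin 8 → Fin 8 → Fin 8 → Fin 8 → ℝ}
    (h₁ : ∀ a b c l, f a b c l = -f b a c l) (h₂ : ∀ a b c l, f a b c l = -f a c b l)
    (hf : ∀ a b c d l, cobd₃ (gC α) f a b c d l = 0) {a b c : Fin 8} (hab : a < b) (hbc : b < c)
    (l : Fin 8) : cobd₂ (gC α) (primitive α f) a b c l = f a b c l := by
  obtain ⟨μ, hμ⟩ : ∃ μ, torusWt α a + torusWt α b + torusWt α c - torusWt α l = μ := ⟨_, rfl⟩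
  have hcongr (g : Fin 8 → Fin 8 → Fin 8 → ℝ)
      (hg : ∀ i j k, torusWt α i + torusWt α j - torusWt α k = μ → primitive α f i j k = g i j k) :
      cobd₂ (gC α) (primitive α f) a b c l = cobd₂ (gC α) g a b c l :=
    cobd₂_congr_of_weight (w := torusWt α) torusWt_add_of_gC_ne_zero
      fun i j k hw => hg i j k (hw.trans hμ)
  by_cases hμ₁ : μ.1 = 0
  · by_cases hμ₂ : μ.2 = 0
    · rw [hcongr (invPrimitive f) fun i j k hw => by simp [primitive, hw, hμ₁, hμ₂]]
      exact cobd₂_invPrimitive hα h₁ h₂ hf hab hbc (hμ.trans (Prod.ext hμ₁ hμ₂))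
    · have key := cobd₃_add_cobd₂_contract (gC_zero_left α) h₁ h₂ a b c l
      have hw : (torusWt α l).2 - (torusWt α a).2 - (torusWt α b).2 - (torusWt α c).2 = -μ.2 := by
        simp only [← hμ, Prod.snd_sub, Prod.snd_add]
        ring
      rw [hf, zero_add, hw] at key
      rw [hcongr (fun i j k => -μ.2⁻¹ * f 0 i j k)
        fun i j k hw => by simp [primitive, hw, hμ₁, hμ₂], cobd₂_smul, key]
      field_simp
  · have key := cobd₃_add_cobd₂_contract (gC_seven_left α) h₁ h₂ a b c l
    have hw : (torusWt α l).1 - (torusWt α a).1 - (torusWt α b).1 - (torusWt α c).1 = -μ.1 := by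
      simp only [← hμ, Prod.fst_sub, Prod.fst_add]
      ring
    rw [hf, zero_add, hw] at key
    rw [hcongr (fun i j k => -μ.1⁻¹ * f 7 i j k)
      fun i j k hw => by simp [primitive, hw, hμ₁], cobd₂_smul, key]
    field_simp

lemma cobd₂_primitive {α : ℝ} (hα : -1 < α) {f : Fin 8 → Fin 8 → Fin 8 → Fin 8 → ℝ}
    (h₁ : ∀ a b c l, f a b c l = -f b a c l) (h₂ : ∀ a b c l, f a b c l = -f a c b l)
    (hf : ∀ a b c d l, cobd₃ (gC α) f a b c d l = 0) (a b c l : Fin 8) :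
    cobd₂ (gC α) (primitive α f) a b c l = f a b c l :=
  sub_eq_zero.mp <| eq_zero_of_increasing
    (F := fun a b c => cobd₂ (gC α) (primitive α f) a b c l - f a b c l)
    (fun a b c => by
      linear_combination cobd₂_swap_left (gC_swap α) (primitive_swap α h₂) a b c l - h₁ a b c l)
    (fun a b c => by
      linear_combination cobd₂_swap_right (gC_swap α) (primitive_swap α h₂) a b c l - h₂ a b c l)
    (fun a b c hab hbc => sub_eq_zero.mpr (cobd₂_primitive_of_lt hα h₁ h₂ hf hab hbc l)) a b c

lemma brOf_basis (C : Fin 8 → Fin 8 → Fin 8 → ℝ) (a b : Fin 8) :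
    brOf C (e8 a) (e8 b) = ∑ m, C a b m • e8 m := by
  ext l
  simp [brOf, e8, Finset.sum_apply]

lemma brOf_basis_left_apply (C : Fin 8 → Fin 8 → Fin 8 → ℝ) (a : Fin 8) (v : V8) (l : Fin 8) :
    brOf C (e8 a) v l = ∑ m, C a m l * v m := by
  simp only [brOf, LinearMap.mk₂_apply, e8]
  rw [Finset.sum_eq_single a] <;> simp +contextual

lemma brOf_basis_apply (C : Fin 8 → Fin 8 → Fin 8 → ℝ) (a b l : Fin 8) :
    brOf C (e8 a) (e8 b) l = C a b l := by
  simp [brOf_basis_left_apply, e8]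

lemma brOf_basis_right_apply (C : Fin 8 → Fin 8 → Fin 8 → ℝ) (v : V8) (a l : Fin 8) :
    brOf C v (e8 a) l = ∑ m, C m a l * v m := by
  simp [brOf, LinearMap.mk₂_apply, e8]

lemma brOf_self {C : Fin 8 → Fin 8 → Fin 8 → ℝ} (hC : ∀ i j k, C i j k = -C j i k) (v : V8) :
    brOf C v v = 0 := by
  ext k
  have : ∑ i, ∑ j, C i j k * v i * v j = -∑ i, ∑ j, C i j k * v i * v j := by
    conv_lhs => rw [Finset.sum_comm]
    simp only [← Finset.sum_neg_distrib]
    refine Finset.sum_congr rfl fun i _ => Finset.sum_congr rfl fun j _ => ?_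
    rw [hC]; ring
  simp only [brOf, LinearMap.mk₂_apply, Pi.zero_apply]
  linarith

/-- The 2-cochain with the given antisymmetric coordinates. -/
noncomputable def cochain₂ (g : Fin 8 → Fin 8 → Fin 8 → ℝ) (hg : ∀ i j k, g i j k = -g j i k) :
    V8 [⋀^Fin 2]→ₗ[ℝ] V8 where
  toFun v := brOf g (v 0) (v 1)
  map_update_add' v i x y := by
    fin_cases i <;> simp
  map_update_smul' v i r x := by
    fin_cases i <;> simp
  map_eq_zero_of_eq' v i j hv hij := by
    have h : v 0 = v 1 := by
      fin_cases i <;> fin_cases j <;> simp_all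
    simp [h, brOf_self hg]

namespace CE

section

variable {V W : Type} [AddCommGroup V] [Module ℝ V] [AddCommGroup W] [Module ℝ W]
  (br : V →ₗ[ℝ] V →ₗ[ℝ] V) (ρ : V →ₗ[ℝ] W →ₗ[ℝ] W)

lemma ceDfun_two (Ψ : V [⋀^Fin 2]→ₗ[ℝ] W) (x y z : V) :
    ceDfun br ρ Ψ ![x, y, z] =
      ρ x (Ψ ![y, z]) - ρ y (Ψ ![x, z]) + ρ z (Ψ ![x, y])
        - Ψ ![br x y, z] + Ψ ![br x z, y] - Ψ ![br y z, x] := by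
  obtain ⟨F, hF⟩ : ∃ F : V → V → W, ∀ v, Ψ v = F (v 0) (v 1) :=
    ⟨fun u v => Ψ ![u, v], fun v => congrArg Ψ (List.ofFn_inj.mp rfl)⟩
  have hsum (G : Fin (2 + 1) → W) : ∑ i, G i = G 0 + G 1 + G 2 := Fin.sum_univ_three G
  simp only [ceDfun, hF, hsum]
  simp [Fin.succAbove]
  module

lemma ceDfun_three (Φ : V [⋀^Fin 3]→ₗ[ℝ] W) (x y z w : V) :
    ceDfun br ρ Φ ![x, y, z, w] =
      ρ x (Φ ![y, z, w]) - ρ y (Φ ![x, z, w]) + ρ z (Φ ![x, y, w]) - ρ w (Φ ![x, y, z])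
        - Φ ![br x y, z, w] + Φ ![br x z, y, w] - Φ ![br x w, y, z]
        - Φ ![br y z, x, w] + Φ ![br y w, x, z] - Φ ![br z w, x, y] := by
  obtain ⟨F, hF⟩ : ∃ F : V → V → V → W, ∀ v, Φ v = F (v 0) (v 1) (v 2) :=
    ⟨fun u v w => Φ ![u, v, w], fun v => congrArg Φ (List.ofFn_inj.mp rfl)⟩
  have hsum (G : Fin (3 + 1) → W) : ∑ i, G i = G 0 + G 1 + G 2 + G 3 := Fin.sum_univ_four G
  simp only [ceDfun, hF, hsum]
  simp [Fin.succAbove]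
  module

end

end CE

lemma map_sum_smul_vecCons (Φ : V8 [⋀^Fin 3]→ₗ[ℝ] V8) (r : Fin 8 → ℝ) (y z : V8) (l : Fin 8) :
    Φ ![∑ m, r m • e8 m, y, z] l = ∑ m, r m * Φ ![e8 m, y, z] l := by
  change Φ.curryLeft (∑ m, r m • e8 m) ![y, z] l = ∑ m, r m * Φ.curryLeft (e8 m) ![y, z] l
  have h (s : Finset (Fin 8)) : Φ.curryLeft (∑ m ∈ s, r m • e8 m) ![y, z] l
      = ∑ m ∈ s, r m * Φ.curryLeft (e8 m) ![y, z] l := by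
    induction s using Finset.cons_induction with
    | empty => simp
    | cons m s hm ih => simp_all
  exact h _

lemma ceDfun_three_basis (C : Fin 8 → Fin 8 → Fin 8 → ℝ) (Φ : V8 [⋀^Fin 3]→ₗ[ℝ] V8)
    (a b c d l : Fin 8) :
    CE.ceDfun (brOf C) (brOf C) Φ ![e8 a, e8 b, e8 c, e8 d] l =
      cobd₃ C (fun a b c => Φ ![e8 a, e8 b, e8 c]) a b c d l := by
  simp only [CE.ceDfun_three, Pi.add_apply, Pi.sub_apply, brOf_basis_left_apply, brOf_basis,
    map_sum_smul_vecCons, cobd₃]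

/-- The coboundary of the 2-cochain `brOf g`, as a multilinear map. -/
noncomputable def multilinearCobd₂ (C g : Fin 8 → Fin 8 → Fin 8 → ℝ) :
    MultilinearMap ℝ (fun _ : Fin 3 => V8) V8 :=
  MultilinearMap.mk' (fun X => brOf C (X 0) (brOf g (X 1) (X 2))
      - brOf C (X 1) (brOf g (X 0) (X 2)) + brOf C (X 2) (brOf g (X 0) (X 1))
      - brOf g (brOf C (X 0) (X 1)) (X 2) + brOf g (brOf C (X 0) (X 2)) (X 1)
      - brOf g (brOf C (X 1) (X 2)) (X 0))
    (fun X i x y => by fin_cases i <;> simp [Function.update] <;> abel)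
    (fun X i r x => by fin_cases i <;> simp [Function.update, smul_sub, smul_add])

lemma ceDfun_cochain₂_eq {C g : Fin 8 → Fin 8 → Fin 8 → ℝ} (hg : ∀ i j k, g i j k = -g j i k)
    (Φ : V8 [⋀^Fin 3]→ₗ[ℝ] V8)
    (h : ∀ a b c l, cobd₂ C g a b c l = Φ ![e8 a, e8 b, e8 c] l) (X : Fin 3 → V8) :
    CE.ceDfun (brOf C) (brOf C) (cochain₂ g hg) X = Φ X := by
  have he (i : Fin 8) : Pi.basisFun ℝ (Fin 8) i = e8 i := by
    ext l
    simp [e8, Pi.single_apply]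
  have hD : multilinearCobd₂ C g = Φ.toMultilinearMap := by
    refine Module.Basis.ext_multilinear (fun _ => Pi.basisFun ℝ (Fin 8)) fun v => ?_
    have hv : (fun i => Pi.basisFun ℝ (Fin 8) (v i)) = ![e8 (v 0), e8 (v 1), e8 (v 2)] := by
      ext i : 1
      fin_cases i <;> simp [-Pi.basisFun_apply, he]
    ext l
    simp only [hv]
    refine Eq.trans ?_ (h _ _ _ l)
    simp only [multilinearCobd₂, MultilinearMap.mk'_apply, Matrix.cons_val, Pi.add_apply,
      Pi.sub_apply, brOf_basis_left_apply, brOf_basis_right_apply, cobd₂]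
    simp [e8, mul_comm]
  have hX : X = ![X 0, X 1, X 2] := by
    ext i : 1
    fin_cases i <;> rfl
  rw [hX, CE.ceDfun_two, ← hX]
  exact congrArg (fun D => D X) hD

theorem third_adjoint_cohomology_vanishes (α : ℝ) (h1 : -1 < α) (h2 : α ≤ 1) :
    ∀ c : CE.CEH (brA α) (brA α) 3, c = 0 := by
  intro c
  induction c using Submodule.Quotient.induction_on with | _ Φ => ?_
  obtain ⟨Φ, hΦ⟩ := Φ
  refine (Submodule.Quotient.mk_eq_zero _).mpr ?_
  have h₁ (a b c l : Fin 8) : Φ ![e8 a, e8 b, e8 c] l = -Φ ![e8 b, e8 a, e8 c] l := by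
    have e : ![e8 a, e8 b, e8 c] = ![e8 b, e8 a, e8 c] ∘ Equiv.swap 0 1 := by
      ext i : 1
      fin_cases i <;> rfl
    rw [e, Φ.map_swap _ (by decide), Pi.neg_apply]
  have h₂ (a b c l : Fin 8) : Φ ![e8 a, e8 b, e8 c] l = -Φ ![e8 a, e8 c, e8 b] l := by
    have e : ![e8 a, e8 b, e8 c] = ![e8 a, e8 c, e8 b] ∘ Equiv.swap 1 2 := by
      ext i : 1
      fin_cases i <;> rfl
    rw [e, Φ.map_swap _ (by decide), Pi.neg_apply]
  have hf (a b c d l : Fin 8) :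
      cobd₃ (gC α) (fun a b c => Φ ![e8 a, e8 b, e8 c]) a b c d l = 0 := by
    rw [← ceDfun_three_basis]
    exact congrFun (congrFun (LinearMap.mem_ker.mp hΦ) ![e8 a, e8 b, e8 c, e8 d]) l
  exact ⟨cochain₂ _ (primitive_swap α h₂),
    funext (ceDfun_cochain₂_eq _ Φ (cobd₂_primitive h1 h₁ h₂ hf))⟩
end

section
/- For −1 ≤ α ≤ 1, the second Chevalley–Eilenberg cohomology of g_α with trivial coefficients satisfies dim H^2(g_α,ℝ) = 0 for α ∉ {−1, 0} and dim H^2(g_α,ℝ) = 1 for α ∈ {−1, 0}. -/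
open Filter Topology Set

namespace CE

variable {V W : Type} [AddCommGroup V] [Module ℝ V] [AddCommGroup W] [Module ℝ W]

lemma ceD_one_zero_apply (br : V →ₗ[ℝ] V →ₗ[ℝ] V) (Φ : V [⋀^Fin 1]→ₗ[ℝ] W) (X : Fin 2 → V) :
    ceD br 0 1 Φ X = -Φ ![br (X 0) (X 1)] := by
  have h : ∀ f : Fin 1 → V, Φ f = Φ ![f 0] := fun f => by
    congr 1; ext i; fin_cases i; rfl
  simp only [ceD, LinearMap.coe_mk, AddHom.coe_mk, ceDfun]
  simp [h (fun i : Fin 1 => _), Fin.sum_univ_succ]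

lemma ceD_two_zero_apply (br : V →ₗ[ℝ] V →ₗ[ℝ] V) (Φ : V [⋀^Fin 2]→ₗ[ℝ] W) (X : Fin 3 → V) :
    ceD br 0 2 Φ X = -Φ ![br (X 0) (X 1), X 2] + Φ ![br (X 0) (X 2), X 1]
      - Φ ![br (X 1) (X 2), X 0] := by
  have h : ∀ f : Fin 2 → V, Φ f = Φ ![f 0, f 1] := fun f => by
    congr 1; ext i; fin_cases i <;> rfl
  simp only [ceD, LinearMap.coe_mk, AddHom.coe_mk, ceDfun]
  simp [h (fun i : Fin 2 => _), Fin.sum_univ_succ, pow_succ]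
  abel

/-- A linear functional vanishing exactly on the coboundaries and not identically zero on the
cocycles forces the cohomology to be one-dimensional. -/
lemma Hdim_eq_one_of_functional (br : V →ₗ[ℝ] V →ₗ[ℝ] V) (ρ : V →ₗ[ℝ] W →ₗ[ℝ] W) (p : ℕ)
    (f : (V [⋀^Fin p]→ₗ[ℝ] W) →ₗ[ℝ] ℝ)
    (hf : ∀ ω ∈ ceZ br ρ p, f ω = 0 ↔ ω ∈ ceB br ρ p)
    (ω₀ : V [⋀^Fin p]→ₗ[ℝ] W) (hω₀ : ω₀ ∈ ceZ br ρ p) (h₀ : f ω₀ ≠ 0) :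
    Hdim br ρ p = 1 := by
  have hker : LinearMap.ker (f ∘ₗ (ceZ br ρ p).subtype)
      = Submodule.comap (ceZ br ρ p).subtype (ceB br ρ p) := by
    ext ω
    simpa using hf ω ω.2
  have hsurj : Function.Surjective (f ∘ₗ (ceZ br ρ p).subtype) :=
    LinearMap.surjective fun h => h₀ (by simpa using LinearMap.congr_fun h ⟨ω₀, hω₀⟩)
  have e := (Submodule.quotEquivOfEq _ _ hker.symm).trans
    (LinearMap.quotKerEquivOfSurjective _ hsurj)
  exact (LinearEquiv.finrank_eq e).trans (Module.finrank_self ℝ)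

lemma Hdim_eq_zero_of_le (br : V →ₗ[ℝ] V →ₗ[ℝ] V) (ρ : V →ₗ[ℝ] W →ₗ[ℝ] W) (p : ℕ)
    (h : ceZ br ρ p ≤ ceB br ρ p) : Hdim br ρ p = 0 := by
  have htop : Submodule.comap (ceZ br ρ p).subtype (ceB br ρ p) = ⊤ :=
    Submodule.comap_subtype_eq_top.2 h
  have : Subsingleton (CEH br ρ p) := Submodule.Quotient.subsingleton_iff.2 htop
  exact Module.finrank_zero_of_subsingleton

end CE

lemma brA_apply_s18 (α : ℝ) (x y : V8) (k : Fin 8) :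
    brA α x y k = ∑ i, ∑ j, gC α i j k * x i * y j := rfl

lemma brA_e8 (α : ℝ) (i j : Fin 8) : brA α (e8 i) (e8 j) = gC α i j := by
  ext k
  simp [brA_apply_s18, e8]

lemma eq_sum_smul_e8 (x : V8) : x = ∑ l, x l • e8 l := by
  ext k; simp [e8]

/-- The pairing of a coordinate vector `f` with the bracket `[e_i, e_j]`, `i < j`. -/
lemma sum_gUpper_mul (α : ℝ) (f : Fin 8 → ℝ) (i j : Fin 8) :
    ∑ l, gUpper α i j l * f l = match (i : ℕ), (j : ℕ) with
      | 0, 1 => 2 * f 1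
      | 0, 2 => -2 * f 2
      | 1, 2 => f 0
      | 0, 3 => f 3
      | 0, 4 => -f 4
      | 0, 5 => f 5
      | 0, 6 => -f 6
      | 1, 4 => f 3
      | 1, 6 => f 5
      | 2, 3 => f 4
      | 2, 5 => f 6
      | 3, 7 => f 3
      | 4, 7 => f 4
      | 5, 7 => α * f 5
      | 6, 7 => α * f 6
      | _, _ => 0 := by
  unfold gUpper
  split <;> simp_all [e8]

lemma gUpper_eq_zero_of_le (α : ℝ) {i j : Fin 8} (h : j ≤ i) : gUpper α i j = 0 := by
  unfold gUpper
  split <;> first | rfl | (exfalso; omega)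

lemma gC_of_lt (α : ℝ) {i j : Fin 8} (h : i < j) (l : Fin 8) : gC α i j l = gUpper α i j l := by
  simp [gC, gUpper_eq_zero_of_le α h.le]

/-- Finite linear algebra behind `H²(g_α, ℝ)`, in terms of the values `w i j = ω(e_i, e_j)`. -/
lemma exists_primitive_of_cocycle_coeff (α : ℝ) (w : Fin 8 → Fin 8 → ℝ)
    (hw : ∀ i j, w i j = -w j i)
    (hc : ∀ i j k, -(∑ l, gC α i j l * w l k) + ∑ l, gC α i k l * w l j
      - ∑ l, gC α j k l * w l i = 0) :
    (1 + α) * w 3 6 = 0 ∧ α * w 5 6 = 0 ∧ (w 3 6 = 0 → w 5 6 = 0 →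
      ∃ φ : Fin 8 → ℝ, ∀ i j, w i j = -∑ l, gC α i j l * φ l) := by
  have d : ∀ i, w i i = 0 := fun i => by linarith [hw i i]
  have hc' : ∀ i j k, i < j → j < k → -(∑ l, gUpper α i j l * w l k)
      + ∑ l, gUpper α i k l * w l j - ∑ l, gUpper α j k l * w l i = 0 := fun i j k hij hjk => by
    simpa [gC_of_lt α hij, gC_of_lt α hjk, gC_of_lt α (hij.trans hjk)] using hc i j k
  simp only [sum_gUpper_mul] at hc'
  have h127 := hc' 1 2 7 (by decide) (by decide)
  have h017 := hc' 0 1 7 (by decide) (by decide)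
  have h027 := hc' 0 2 7 (by decide) (by decide)
  have h013 := hc' 0 1 3 (by decide) (by decide)
  have h014 := hc' 0 1 4 (by decide) (by decide)
  have h015 := hc' 0 1 5 (by decide) (by decide)
  have h016 := hc' 0 1 6 (by decide) (by decide)
  have h023 := hc' 0 2 3 (by decide) (by decide)
  have h024 := hc' 0 2 4 (by decide) (by decide)
  have h025 := hc' 0 2 5 (by decide) (by decide)
  have h026 := hc' 0 2 6 (by decide) (by decide)
  have h037 := hc' 0 3 7 (by decide) (by decide)
  have h047 := hc' 0 4 7 (by decide) (by decide)
  have h057 := hc' 0 5 7 (by decide) (by decide)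
  have h067 := hc' 0 6 7 (by decide) (by decide)
  have h347 := hc' 3 4 7 (by decide) (by decide)
  have h035 := hc' 0 3 5 (by decide) (by decide)
  have h046 := hc' 0 4 6 (by decide) (by decide)
  have h146 := hc' 1 4 6 (by decide) (by decide)
  have h367 := hc' 3 6 7 (by decide) (by decide)
  have h567 := hc' 5 6 7 (by decide) (by decide)
  clear hc hc'
  simp at h127 h017 h027 h013 h014 h015 h016 h023 h024 h025 h026 h037 h047 h057 h067
  simp at h347 h035 h046 h146 h367 h567
  refine ⟨by linear_combination h367 + α * hw 3 6,
    by linear_combination (h567 + α * hw 5 6) / 2, fun h36 h56 =>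
    ⟨![-w 1 2, -w 0 1 / 2, w 0 2 / 2, -w 0 3, w 0 4, -w 0 5, w 0 6, 0], ?_⟩⟩
  rw [hw 5 0] at h057
  rw [hw 6 0] at h067
  have hcases : ∀ i : Fin 8, i = 0 ∨ i = 1 ∨ i = 2 ∨ i = 3 ∨ i = 4 ∨ i = 5 ∨ i = 6 ∨ i = 7 := by
    decide
  have key : ∀ i j : Fin 8, i < j → w i j = -∑ l, gC α i j l *
      ![-w 1 2, -w 0 1 / 2, w 0 2 / 2, -w 0 3, w 0 4, -w 0 5, w 0 6, 0] l := by
    intro i j hij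
    simp only [gC_of_lt α hij, sum_gUpper_mul]
    rcases hcases i with rfl | rfl | rfl | rfl | rfl | rfl | rfl | rfl <;>
    rcases hcases j with rfl | rfl | rfl | rfl | rfl | rfl | rfl | rfl <;>
    simp at hij ⊢ <;>
    first
    | ring1
    | linarith [hw 3 0, hw 4 0, hw 5 0, hw 6 0, hw 3 1, hw 4 1, hw 5 1, hw 6 1, hw 3 2, hw 4 2,
        hw 5 2, hw 6 2, hw 4 3, hw 5 3, hw 5 4, hw 6 4]
  intro i j
  rcases lt_trichotomy i j with h | rfl | h
  · exact key i j h
  · simp [d, gC]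
  · rw [hw, key j i h, ← Finset.sum_neg_distrib]
    congr 1
    exact Finset.sum_congr rfl fun l _ => by simp only [gC]; ring

lemma alternating_two_eq_sum (ω : V8 [⋀^Fin 2]→ₗ[ℝ] ℝ) (x y : V8) :
    ω ![x, y] = ∑ l, x l * ω ![e8 l, y] := by
  have h (z : V8) : ω ![z, y] = ω.toMultilinearMap.toLinearMap ![0, y] 0 z := by
    change _ = ω (Function.update ![0, y] 0 z)
    congr 1; ext i; fin_cases i <;> rfl
  simp_rw [h]
  conv_lhs => rw [eq_sum_smul_e8 x]
  simp only [map_sum, map_smul, smul_eq_mul]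

lemma alternating_two_swap (ω : V8 [⋀^Fin 2]→ₗ[ℝ] ℝ) (x y : V8) : ω ![x, y] = -ω ![y, x] := by
  rw [← ω.map_swap ![y, x] (i := 0) (j := 1) (by decide)]
  congr 1
  ext i; fin_cases i <;> rfl

lemma alternating_two_eq_sum_sum (ω : V8 [⋀^Fin 2]→ₗ[ℝ] ℝ) (x y : V8) :
    ω ![x, y] = ∑ i, ∑ j, x i * y j * ω ![e8 i, e8 j] := by
  rw [alternating_two_eq_sum]
  refine Finset.sum_congr rfl fun i _ => ?_
  rw [alternating_two_swap, alternating_two_eq_sum, ← Finset.sum_neg_distrib, Finset.mul_sum]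
  refine Finset.sum_congr rfl fun j _ => ?_
  rw [alternating_two_swap ω (e8 i)]
  ring

open CE

lemma cocycle_coeff {α : ℝ} {ω : V8 [⋀^Fin 2]→ₗ[ℝ] ℝ} (hω : ω ∈ ceZ (brA α) 0 2) :
    (1 + α) * ω ![e8 3, e8 6] = 0 ∧ α * ω ![e8 5, e8 6] = 0 ∧
      (ω ![e8 3, e8 6] = 0 → ω ![e8 5, e8 6] = 0 → ω ∈ ceB (brA α) 0 2) := by
  obtain ⟨h1, h2, h3⟩ := exists_primitive_of_cocycle_coeff α (fun i j => ω ![e8 i, e8 j])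
    (fun i j => alternating_two_swap ω _ _) fun i j k => by
      have h := congr_fun (LinearMap.mem_ker.1 hω) ![e8 i, e8 j, e8 k]
      rw [ceD_two_zero_apply] at h
      simpa [brA_e8, alternating_two_eq_sum ω (gC _ _ _)] using h
  refine ⟨h1, h2, fun h36 h56 => ?_⟩
  obtain ⟨φ, hφ⟩ := h3 h36 h56
  let L : V8 →ₗ[ℝ] ℝ := ∑ l, φ l • LinearMap.proj l
  let Φ : V8 [⋀^Fin 1]→ₗ[ℝ] ℝ := AlternatingMap.ofSubsingleton ℝ V8 ℝ 0 L
  have hΦ (z : V8) : Φ ![z] = ∑ l, z l * φ l := by simp [Φ, L, mul_comm]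
  refine ⟨Φ, funext fun X => ?_⟩
  rw [ceD_one_zero_apply, hΦ]
  have hX : X = ![X 0, X 1] := by ext1 i; fin_cases i <;> rfl
  change _ = ω X
  rw [hX, alternating_two_eq_sum_sum]
  simp_rw [hφ, brA_apply_s18, Finset.sum_mul, mul_neg, Finset.mul_sum, Finset.sum_neg_distrib]
  rw [Finset.sum_comm]
  refine congr_arg _ (Finset.sum_congr rfl fun i _ => ?_)
  rw [Finset.sum_comm]
  refine Finset.sum_congr rfl fun j _ => Finset.sum_congr rfl fun l _ => ?_
  simp only [Matrix.cons_val_zero, Matrix.cons_val_one]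
  ring

/-- The alternating form `e_a^* ∧ e_b^*` on `ℝ⁸`. -/
noncomputable def coordWedge (a b : Fin 8) : V8 [⋀^Fin 2]→ₗ[ℝ] ℝ :=
  (Matrix.detRowAlternating (R := ℝ) (n := Fin 2)).compLinearMap (LinearMap.funLeft ℝ ℝ ![a, b])

lemma coordWedge_apply (a b : Fin 8) (x y : V8) :
    coordWedge a b ![x, y] = x a * y b - x b * y a :=
  Matrix.det_fin_two (fun i => LinearMap.funLeft ℝ ℝ ![a, b] (![x, y] i))

lemma brA_apply_three (α : ℝ) (x y : V8) : brA α x y 3 =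
    x 0 * y 3 - x 3 * y 0 + x 1 * y 4 - x 4 * y 1 + x 3 * y 7 - x 7 * y 3 := by
  simp [brA_apply_s18, Fin.sum_univ_eight, gC, gUpper, e8]; ring

lemma brA_apply_four (α : ℝ) (x y : V8) : brA α x y 4 =
    x 4 * y 0 - x 0 * y 4 + x 2 * y 3 - x 3 * y 2 + x 4 * y 7 - x 7 * y 4 := by
  simp [brA_apply_s18, Fin.sum_univ_eight, gC, gUpper, e8]; ring

lemma brA_apply_five (α : ℝ) (x y : V8) : brA α x y 5 =
    x 0 * y 5 - x 5 * y 0 + x 1 * y 6 - x 6 * y 1 + α * (x 5 * y 7 - x 7 * y 5) := by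
  simp [brA_apply_s18, Fin.sum_univ_eight, gC, gUpper, e8]; ring

lemma brA_apply_six (α : ℝ) (x y : V8) : brA α x y 6 =
    x 6 * y 0 - x 0 * y 6 + x 2 * y 5 - x 5 * y 2 + α * (x 6 * y 7 - x 7 * y 6) := by
  simp [brA_apply_s18, Fin.sum_univ_eight, gC, gUpper, e8]; ring

lemma coordWedge_mem_ceZ_zero : coordWedge 5 6 ∈ ceZ (brA 0) 0 2 := by
  refine LinearMap.mem_ker.2 (funext fun X => ?_)
  rw [ceD_two_zero_apply]
  simp only [coordWedge_apply, brA_apply_five, brA_apply_six, Pi.zero_apply]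
  ring

lemma coordWedge_sub_mem_ceZ_neg_one :
    coordWedge 3 6 - coordWedge 4 5 ∈ ceZ (brA (-1)) 0 2 := by
  refine LinearMap.mem_ker.2 (funext fun X => ?_)
  rw [ceD_two_zero_apply]
  simp only [AlternatingMap.sub_apply, coordWedge_apply, brA_apply_three, brA_apply_four,
    brA_apply_five, brA_apply_six, Pi.zero_apply]
  ring

/-- Coboundaries vanish on pairs of commuting elements. -/
lemma ceB_apply_eq_zero {α : ℝ} {ω : V8 [⋀^Fin 2]→ₗ[ℝ] ℝ} (hω : ω ∈ ceB (brA α) 0 2)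
    {x y : V8} (h : brA α x y = 0) : ω ![x, y] = 0 := by
  obtain ⟨Φ, hΦ⟩ := hω
  have := congr_fun hΦ ![x, y]
  rw [ceD_one_zero_apply] at this
  simp only [Matrix.cons_val_zero, Matrix.cons_val_one, h] at this
  rw [show ω ![x, y] = altEval 2 ω ![x, y] from rfl, ← this, Φ.map_coord_zero 0 rfl, neg_zero]

lemma brA_e8_eq_zero (α : ℝ) {i : Fin 8} (h : i = 3 ∨ i = 5) :
    brA α (e8 i) (e8 6) = 0 := by
  rw [brA_e8]
  ext l
  rcases h with rfl | rfl <;> simp [gC, gUpper]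

open CE in
/-- For `−1 ≤ α ≤ 1`, `dim H²(g_α,ℝ) = 0` for `α ∉ {−1,0}` and `dim H²(g_α,ℝ) = 1`
for `α ∈ {−1,0}` (trivial coefficients: `ρ = 0`). -/
theorem second_trivial_cohomology_of_family (α : ℝ) (hα : α ∈ Set.Icc (-1 : ℝ) 1) :
    (α ≠ -1 → α ≠ 0 → Hdim (brA α) (0 : V8 →ₗ[ℝ] ℝ →ₗ[ℝ] ℝ) 2 = 0) ∧
    (α = -1 ∨ α = 0 → Hdim (brA α) (0 : V8 →ₗ[ℝ] ℝ →ₗ[ℝ] ℝ) 2 = 1) := by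
  have eval (x y : V8) : ∃ f : (V8 [⋀^Fin 2]→ₗ[ℝ] ℝ) →ₗ[ℝ] ℝ, ∀ ω, f ω = ω ![x, y] :=
    ⟨LinearMap.proj ![x, y] ∘ₗ altEval 2, fun _ => rfl⟩
  refine ⟨fun h1 h0 => Hdim_eq_zero_of_le _ _ _ fun ω hω => ?_, ?_⟩
  · obtain ⟨h36, h56, h⟩ := cocycle_coeff hω
    exact h ((mul_eq_zero.1 h36).resolve_left fun h => h1 (by linarith))
      ((mul_eq_zero.1 h56).resolve_left h0)
  · rintro (rfl | rfl)
    · obtain ⟨f, hf⟩ := eval (e8 3) (e8 6)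
      refine Hdim_eq_one_of_functional _ _ _ f (fun ω hω => ?_) _
        coordWedge_sub_mem_ceZ_neg_one (by simp [hf, coordWedge_apply, e8])
      obtain ⟨-, h56, h⟩ := cocycle_coeff hω
      rw [hf]
      exact ⟨fun h36 => h h36 (by linarith),
        fun hB => ceB_apply_eq_zero hB (brA_e8_eq_zero _ (.inl rfl))⟩
    · obtain ⟨f, hf⟩ := eval (e8 5) (e8 6)
      refine Hdim_eq_one_of_functional _ _ _ f (fun ω hω => ?_) _
        coordWedge_mem_ceZ_zero (by simp [hf, coordWedge_apply, e8])
      obtain ⟨h36, -, h⟩ := cocycle_coeff hω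
      rw [hf]
      exact ⟨fun h56 => h (by linarith) h56,
        fun hB => ceB_apply_eq_zero hB (brA_e8_eq_zero _ (.inr rfl))⟩
end
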